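/- arXiv:2604.26723 — 4 statements merged into one kernel-verified Lean document; each statement's English description precedes it below -/
import Mathlib

section
/- Let φ, ψ ∈ End(V), where φ admits an AST decomposition with subspaces W_φ, U_φ and index m, and ψ admits an AST decomposition with subspaces W_ψ, U_ψ and index s. If φ ≤^{GD1} ψ, then W_φ ⊆ W_ψ, and moreover W_ψ decomposes as the internal direct sum W_ψ = W_φ ⊕ (U_φ ∩ W_ψ), i.e. W_φ + (U_φ ∩ W_ψ) = W_ψ and W_φ ∩ (U_φ ∩ W_ψ) = 0. -/
/-- `h` is a `{1}`-inverse of `φ`: `φ∘h∘φ = φ`. -/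
def IsOneInv {k V : Type*} [Field k] [AddCommGroup V] [Module k V]
    (φ h : Module.End k V) : Prop := φ * h * φ = φ

/-- `g` is a G-Drazin inverse of `φ` (of index `m`): `φ∘g∘φ = φ` and `g∘φ^m = φ^m∘g`. -/
def IsGDrazin {k V : Type*} [Field k] [AddCommGroup V] [Module k V]
    (φ : Module.End k V) (m : ℕ) (g : Module.End k V) : Prop :=
  φ * g * φ = φ ∧ g * φ ^ m = φ ^ m * g

/-- `ψ` is a GD1 inverse of `φ` (of index `m`). -/
def IsGD1 {k V : Type*} [Field k] [AddCommGroup V] [Module k V]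
    (φ : Module.End k V) (m : ℕ) (ψ : Module.End k V) : Prop :=
  ψ * φ * ψ = ψ ∧ ∃ g h : Module.End k V,
    IsGDrazin φ m g ∧ IsOneInv φ h ∧ ψ * φ = g * φ ∧ φ * ψ = φ * h

/-- `ψ` is a 1GD inverse of `φ` (of index `m`). -/
def Is1GD {k V : Type*} [Field k] [AddCommGroup V] [Module k V]
    (φ : Module.End k V) (m : ℕ) (ψ : Module.End k V) : Prop :=
  ψ * φ * ψ = ψ ∧ ∃ h g : Module.End k V,
    IsOneInv φ h ∧ IsGDrazin φ m g ∧ ψ * φ = h * φ ∧ φ * ψ = φ * g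

/-- `φ` admits an AST decomposition with subspaces `W`, `U` and index `m`. -/
def IsAST {k V : Type*} [Field k] [AddCommGroup V] [Module k V]
    (φ : Module.End k V) (W U : Submodule k V) (m : ℕ) : Prop :=
  IsCompl W U ∧ (∀ w ∈ W, φ w ∈ W) ∧ (∀ u ∈ U, φ u ∈ U) ∧
  FiniteDimensional k W ∧ Set.BijOn (⇑φ) (W : Set V) (W : Set V) ∧
  IsLeast {n : ℕ | ∀ u ∈ U, (φ ^ n) u = 0} m

/-- `φ` is finite potent: `φ^n(V)` is finite dimensional for some `n`. -/
def IsFinitePotent {k V : Type*} [Field k] [AddCommGroup V] [Module k V]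
    (φ : Module.End k V) : Prop :=
  ∃ n : ℕ, FiniteDimensional k (LinearMap.range (φ ^ n))

/-- The index of `φ`: the least `m` with `ker (φ^m) = ker (φ^(m+1))`. -/
noncomputable def endIndex {k V : Type*} [Field k] [AddCommGroup V] [Module k V]
    (φ : Module.End k V) : ℕ :=
  sInf {m : ℕ | LinearMap.ker (φ ^ m) = LinearMap.ker (φ ^ (m + 1))}

/-- The minus order: `φ ≤⁻ ψ`. -/
def MinusLe {k V : Type*} [Field k] [AddCommGroup V] [Module k V]
    (φ ψ : Module.End k V) : Prop :=
  ∃ h : Module.End k V, IsOneInv φ h ∧ h * φ = h * ψ ∧ φ * h = ψ * h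

/-- The GD1 relation `φ ≤^{GD1} ψ` (with `m` the index of `φ`). -/
def GD1Le {k V : Type*} [Field k] [AddCommGroup V] [Module k V]
    (φ : Module.End k V) (m : ℕ) (ψ : Module.End k V) : Prop :=
  ∃ τ : Module.End k V, IsGD1 φ m τ ∧ φ * τ = ψ * τ ∧ τ * φ = τ * ψ

/-- The 1GD relation `φ ≤^{1GD} ψ` (with `m` the index of `φ`). -/
def OneGDLe {k V : Type*} [Field k] [AddCommGroup V] [Module k V]
    (φ : Module.End k V) (m : ℕ) (ψ : Module.End k V) : Prop :=
  ∃ τ : Module.End k V, Is1GD φ m τ ∧ φ * τ = ψ * τ ∧ τ * φ = τ * ψ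

theorem IsAST.range_pow_mem {k V : Type*} [Field k] [AddCommGroup V] [Module k V]
    {φ : Module.End k V} {W U : Submodule k V} {m : ℕ} (h : IsAST φ W U m) (v : V) :
    (φ ^ m) v ∈ W := by
  obtain ⟨hc, hW, -, -, -, hm, -⟩ := h
  have hv : v ∈ W ⊔ U := hc.sup_eq_top ▸ Submodule.mem_top
  obtain ⟨w, hw, u, hu, rfl⟩ := Submodule.mem_sup.mp hv
  rw [map_add, hm u hu, add_zero]
  exact Module.End.pow_apply_mem_of_forall_mem m hW w hw

theorem exists_pow_apply_eq_of_surjOn {k V : Type*} [Field k] [AddCommGroup V] [Module k V]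
    {φ : Module.End k V} {W : Submodule k V} (h : Set.SurjOn φ (W : Set V) (W : Set V))
    (n : ℕ) {w : V} (hw : w ∈ W) : ∃ v ∈ W, (φ ^ n) v = w := by
  rw [Module.End.coe_pow]
  exact h.iterate n hw

/-- A G-Drazin inverse inverts `φ` on the core part of the AST decomposition. -/
theorem IsGDrazin.apply_apply_of_mem {k V : Type*} [Field k] [AddCommGroup V] [Module k V]
    {φ g : Module.End k V} {W U : Submodule k V} {m : ℕ} (h : IsAST φ W U m)
    (hg : IsGDrazin φ m g) {w : V} (hw : w ∈ W) : g (φ w) = w := by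
  have hbij := h.2.2.2.2.1
  obtain ⟨v, -, hv⟩ := exists_pow_apply_eq_of_surjOn hbij.surjOn m (h.2.1 w hw)
  have hmem : g (φ w) ∈ W := by
    rw [← hv, ← Module.End.mul_apply, hg.2]
    exact h.range_pow_mem (g v)
  exact hbij.injOn hmem hw (LinearMap.congr_fun hg.1 w)

/-- If `φ ≤^{GD1} ψ`, then `φ` and `ψ` agree on the core part of `φ`. -/
theorem GD1Le.apply_eq_of_mem {k V : Type*} [Field k] [AddCommGroup V] [Module k V]
    {φ ψ : Module.End k V} {W U : Submodule k V} {m : ℕ} (h : IsAST φ W U m)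
    (hle : GD1Le φ m ψ) {w : V} (hw : w ∈ W) : ψ w = φ w := by
  obtain ⟨τ, ⟨-, g, -, hg, -, hτ, -⟩, hφψ, -⟩ := hle
  have hτw : τ (φ w) = w := (LinearMap.congr_fun hτ w).trans (hg.apply_apply_of_mem h hw)
  have := LinearMap.congr_fun hφψ (φ w)
  simp only [Module.End.mul_apply, hτw] at this
  exact this.symm

theorem stmt12 {k V : Type*} [Field k] [AddCommGroup V] [Module k V]
    (φ ψ : Module.End k V) (Wφ Uφ Wψ Uψ : Submodule k V) (m s : ℕ)
    (hASTφ : IsAST φ Wφ Uφ m) (hASTψ : IsAST ψ Wψ Uψ s) (hle : GD1Le φ m ψ) :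
    Wφ ≤ Wψ ∧ Wφ ⊔ (Uφ ⊓ Wψ) = Wψ ∧ Wφ ⊓ (Uφ ⊓ Wψ) = ⊥ := by
  have hφψ : Set.EqOn φ ψ (Wφ : Set V) := fun _ hw => (hle.apply_eq_of_mem hASTφ hw).symm
  have hsurj : Set.SurjOn ψ (Wφ : Set V) (Wφ : Set V) := hASTφ.2.2.2.2.1.surjOn.congr hφψ
  have hWW : Wφ ≤ Wψ := by
    intro w hw
    obtain ⟨v, -, rfl⟩ := exists_pow_apply_eq_of_surjOn hsurj s hw
    exact hASTψ.range_pow_mem v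
  refine ⟨hWW, ?_, ?_⟩
  · rw [← sup_inf_assoc_of_le Uφ hWW, hASTφ.1.sup_eq_top, top_inf_eq]
  · rw [← inf_assoc, hASTφ.1.inf_eq_bot, bot_inf_eq]
end

section
/- Let φ, ψ ∈ End(V), where φ admits an AST decomposition with subspaces W_φ, U_φ and index m, and ψ admits an AST decomposition with subspaces W_ψ, U_ψ and index s. If φ ≤^{1GD} ψ, then U_ψ ⊆ U_φ, and moreover U_φ decomposes as the internal direct sum U_φ = U_ψ ⊕ (W_ψ ∩ U_φ), i.e. U_ψ + (W_ψ ∩ U_φ) = U_φ and U_ψ ∩ (W_ψ ∩ U_φ) = 0. -/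
/-- The nilpotent part of an AST decomposition of index `m` is `ker (φ ^ m)`. -/
theorem IsAST.ker_pow {k V : Type*} [Field k] [AddCommGroup V] [Module k V]
    {φ : Module.End k V} {W U : Submodule k V} {m : ℕ} (h : IsAST φ W U m) :
    LinearMap.ker (φ ^ m) = U := by
  obtain ⟨hc, -, -, -, hb, hm, -⟩ := h
  refine le_antisymm (fun x hx => ?_) fun u hu => hm u hu
  obtain ⟨w, hw, u, hu, rfl⟩ :=
    Submodule.mem_sup.1 (hc.sup_eq_top.symm ▸ Submodule.mem_top : x ∈ W ⊔ U)
  have hw0 : (φ ^ m) w = 0 := by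
    have hu0 : (φ ^ m) u = 0 := hm u hu
    rwa [LinearMap.mem_ker, map_add, hu0, add_zero] at hx
  have hinj : Set.InjOn (⇑(φ ^ m)) (W : Set V) := by
    rw [Module.End.coe_pow]
    exact hb.injOn.iterate hb.mapsTo m
  have : w = 0 := hinj hw W.zero_mem (by rw [hw0, map_zero])
  rwa [this, zero_add]

/-- If `φ ≤^{1GD} ψ` and `φ` has nilpotent part of index `m`, then `φ ^ m` factors
through `ψ` as `g * φ ^ m * ψ`. -/
theorem OneGDLe.exists_pow_eq {k V : Type*} [Field k] [AddCommGroup V] [Module k V]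
    {φ ψ : Module.End k V} {W U : Submodule k V} {m : ℕ} (h : IsAST φ W U m)
    (hle : OneGDLe φ m ψ) : ∃ g : Module.End k V, g * φ ^ m * ψ = φ ^ m := by
  obtain ⟨τ, ⟨-, a, g, ha, ⟨-, hg⟩, hτa, hτg⟩, -, hτψ⟩ := hle
  have hφ : φ * (g * ψ) = φ := by
    rw [← mul_assoc, ← hτg, mul_assoc, ← hτψ, hτa, ← mul_assoc]
    exact ha
  refine ⟨g, ?_⟩
  rw [hg, mul_assoc]
  cases m with
  | succ n => rw [pow_succ, mul_assoc, hφ]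
  | zero =>
    have hU : U = ⊥ := by rw [← h.ker_pow, pow_zero]; exact LinearMap.ker_id
    have hW : W = ⊤ := by simpa [hU] using h.1.sup_eq_top
    have hb := h.2.2.2.2.1
    rw [pow_zero, one_mul]
    ext x
    exact hb.injOn (by simp [hW]) (by simp [hW]) (LinearMap.congr_fun hφ x)

theorem stmt16 {k V : Type*} [Field k] [AddCommGroup V] [Module k V]
    (φ ψ : Module.End k V) (Wφ Uφ Wψ Uψ : Submodule k V) (m s : ℕ)
    (hASTφ : IsAST φ Wφ Uφ m) (hASTψ : IsAST ψ Wψ Uψ s) (hle : OneGDLe φ m ψ) :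
    Uψ ≤ Uφ ∧ Uψ ⊔ (Wψ ⊓ Uφ) = Uφ ∧ Uψ ⊓ (Wψ ⊓ Uφ) = ⊥ := by
  have hU : Uψ ≤ Uφ := by
    obtain ⟨g, hg⟩ := hle.exists_pow_eq hASTφ
    have hpow (n : ℕ) : g ^ n * φ ^ m * ψ ^ n = φ ^ m := by
      induction n with
      | zero => simp
      | succ n ih =>
        calc g ^ (n + 1) * φ ^ m * ψ ^ (n + 1)
            = g ^ n * (g * φ ^ m * ψ) * ψ ^ n := by
              rw [pow_succ, pow_succ']; simp only [mul_assoc]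
          _ = φ ^ m := by rw [hg, ih]
    rw [← hASTφ.ker_pow, ← hASTψ.ker_pow, ← hpow s]
    exact LinearMap.ker_le_ker_comp _ _
  refine ⟨hU, ?_, ?_⟩
  · rw [← sup_inf_assoc_of_le _ hU, sup_comm, hASTψ.1.sup_eq_top, top_inf_eq]
  · rw [← inf_assoc, inf_comm Uψ, hASTψ.1.inf_eq_bot, bot_inf_eq]
end

section
/- Let φ, ψ ∈ End(V), where φ admits an AST decomposition with subspaces W_φ, U_φ and index m, and ψ is finite potent. Then φ ≤^{1GD} ψ if and only if both: (I) range(ψ − φ) ⊆ U_φ, and (II) φ ≤^- ψ (minus order). -/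
theorem IsOneInv.apply {k V : Type*} [Field k] [AddCommGroup V] [Module k V]
    {φ h : Module.End k V} (hh : IsOneInv φ h) (x : V) : φ (h (φ x)) = φ x :=
  LinearMap.congr_fun hh x

theorem IsAST.pow_apply_mem {k V : Type*} [Field k] [AddCommGroup V] [Module k V]
    {φ : Module.End k V} {W U : Submodule k V} {m : ℕ} (hA : IsAST φ W U m) (n : ℕ)
    {w : V} (hw : w ∈ W) : (φ ^ n) w ∈ W := by
  induction n with
  | zero => simpa using hw
  | succ n ih =>
    rw [pow_succ', Module.End.mul_apply]
    exact hA.2.1 _ ih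

theorem IsAST.pow_apply_eq_zero {k V : Type*} [Field k] [AddCommGroup V] [Module k V]
    {φ : Module.End k V} {W U : Submodule k V} {m : ℕ} (hA : IsAST φ W U m)
    {u : V} (hu : u ∈ U) : (φ ^ m) u = 0 :=
  hA.2.2.2.2.2.1 u hu

theorem IsAST.exists_apply_eq {k V : Type*} [Field k] [AddCommGroup V] [Module k V]
    {φ : Module.End k V} {W U : Submodule k V} {m : ℕ} (hA : IsAST φ W U m)
    {w : V} (hw : w ∈ W) : ∃ y ∈ W, φ y = w :=
  hA.2.2.2.2.1.surjOn hw

theorem IsAST.eq_zero_of_pow_apply_eq_zero {k V : Type*} [Field k] [AddCommGroup V] [Module k V]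
    {φ : Module.End k V} {W U : Submodule k V} {m : ℕ} (hA : IsAST φ W U m) (n : ℕ)
    {w : V} (hw : w ∈ W) (h : (φ ^ n) w = 0) : w = 0 := by
  induction n with
  | zero => simpa using h
  | succ n ih =>
    rw [pow_succ', Module.End.mul_apply] at h
    exact ih (hA.2.2.2.2.1.injOn (hA.pow_apply_mem n hw) W.zero_mem (by rw [h, map_zero]))

/-- The projection onto `W` along `U` in an AST decomposition, with its basic properties. -/
theorem IsAST.exists_projection {k V : Type*} [Field k] [AddCommGroup V] [Module k V]
    {φ : Module.End k V} {W U : Submodule k V} {m : ℕ} (hA : IsAST φ W U m) :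
    ∃ P : Module.End k V, (∀ x, P x ∈ W) ∧ (∀ x, x - P x ∈ U) ∧ (∀ w ∈ W, P w = w) ∧
      (∀ u ∈ U, P u = 0) ∧ ∀ x, P (φ x) = φ (P x) := by
  have hc := hA.1
  have hmem : ∀ x, W.projection U hc x ∈ W := Submodule.projection_apply_mem hc
  have hW : ∀ w ∈ W, W.projection U hc w = w := fun _ hw =>
    Submodule.projection_apply_of_mem_left hc hw
  have hU : ∀ u ∈ U, W.projection U hc u = 0 := fun _ hu =>
    (Submodule.projection_apply_eq_zero_iff hc).2 hu
  have hsub : ∀ x, x - W.projection U hc x ∈ U := Submodule.sub_projection_mem hc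
  refine ⟨W.projection U hc, hmem, hsub, hW, hU, fun x => ?_⟩
  have h1 := hU _ (hA.2.2.1 _ (hsub x))
  rw [map_sub, map_sub, sub_eq_zero] at h1
  rw [h1, hW _ (hA.2.1 _ (hmem x))]

theorem Is1GD.isOneInv {k V : Type*} [Field k] [AddCommGroup V] [Module k V]
    {φ τ : Module.End k V} {m : ℕ} (hτ : Is1GD φ m τ) : IsOneInv φ τ := by
  obtain ⟨-, h, g, hh, -, hτφ, -⟩ := hτ
  rw [IsOneInv, mul_assoc, hτφ, ← mul_assoc, hh]

theorem OneGDLe.minusLe {k V : Type*} [Field k] [AddCommGroup V] [Module k V]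
    {φ ψ : Module.End k V} {m : ℕ} (H : OneGDLe φ m ψ) : MinusLe φ ψ := by
  obtain ⟨τ, hτ, h1, h2⟩ := H
  exact ⟨τ, hτ.isOneInv, h2, h1⟩

theorem OneGDLe.range_sub_le {k V : Type*} [Field k] [AddCommGroup V] [Module k V]
    {φ ψ : Module.End k V} {W U : Submodule k V} {m : ℕ} (hA : IsAST φ W U m)
    (H : OneGDLe φ m ψ) : LinearMap.range (ψ - φ) ≤ U := by
  obtain ⟨τ, ⟨-, -, g, -, ⟨hg, hcomm⟩, -, hφτ⟩, -, h2⟩ := H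
  obtain ⟨P, hPW, hPU, -, -, -⟩ := hA.exists_projection
  rintro _ ⟨x, rfl⟩
  set d := (ψ - φ) x with hd
  have hτd : τ d = 0 := by
    have := LinearMap.congr_fun h2 x
    simp only [Module.End.mul_apply] at this
    rw [hd, LinearMap.sub_apply, map_sub, this, sub_self]
  have hgd : φ (g d) = 0 := by
    have := LinearMap.congr_fun hφτ d
    simp only [Module.End.mul_apply] at this
    rw [← this, hτd, map_zero]
  have hdP : (φ ^ m) d = (φ ^ m) (P d) := by
    rw [← sub_eq_zero, ← map_sub]
    exact hA.pow_apply_eq_zero (hPU d)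
  obtain ⟨y, -, hy⟩ := hA.exists_apply_eq (hA.pow_apply_mem m (hPW d))
  have hcd : g ((φ ^ m) d) = (φ ^ m) (g d) := LinearMap.congr_fun hcomm d
  have hz : (φ ^ m) (P d) = 0 := by
    rw [← hy, ← IsOneInv.apply hg, hy, ← hdP, hcd, ← Module.End.mul_apply, ← pow_succ',
      pow_succ, Module.End.mul_apply, hgd, map_zero]
  have hP0 := hA.eq_zero_of_pow_apply_eq_zero m (hPW d) hz
  simpa [hP0] using hPU d

/-- A `{1}`-inverse compressed to both summands of an AST decomposition is a G-Drazin inverse. -/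
theorem IsOneInv.isGDrazin_compression {k V : Type*} [Field k] [AddCommGroup V] [Module k V]
    {φ h P Q : Module.End k V} {m : ℕ} (hh : IsOneInv φ h) (hPQ : P + Q = 1)
    (hPP : P * P = P) (hQQ : Q * Q = Q) (hP : Commute P φ) (hQ : Commute Q φ)
    (hhP : φ * h * P = P) (hinj : ∀ x, φ (P x) = 0 → P x = 0) (hQm : φ ^ m * Q = 0) :
    IsGDrazin φ m (P * h * P + Q * h * Q) := by
  rw [IsOneInv] at hh
  have hPa : φ * (P * h * P) = P := by
    rw [mul_assoc P, ← mul_assoc, ← hP.eq, mul_assoc, ← mul_assoc φ, hhP, hPP]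
  have hPb : P * h * P * φ = P := by
    rw [← sub_eq_zero]
    have hfac : P * h * P * φ - P = P * (h * P * φ - P) := by
      rw [mul_sub, hPP]
      simp only [mul_assoc]
    rw [hfac]
    ext x
    refine hinj _ ?_
    have : φ * (P * (h * P * φ - P)) = 0 := by
      rw [← hfac, mul_sub, ← mul_assoc, hPa, hP.eq, sub_self]
    exact LinearMap.congr_fun this x
  have hQa : φ * (Q * h * Q) * φ = φ * Q := by
    calc φ * (Q * h * Q) * φ = (φ * Q) * h * (Q * φ) := by simp only [mul_assoc]
      _ = (Q * φ) * h * (φ * Q) := by rw [hQ.eq]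
      _ = Q * (φ * h * φ) * Q := by simp only [mul_assoc]
      _ = φ * Q := by rw [hh, hQ.eq, mul_assoc, hQQ]
  have hmQ : Q * φ ^ m = 0 := by rw [(hQ.pow_right m).eq, hQm]
  have hc : Commute (P * h * P) φ := by rw [Commute, SemiconjBy, hPa, hPb]
  refine ⟨?_, ?_⟩
  · rw [mul_add, add_mul, hPa, hQa, hP.eq, ← mul_add, hPQ, mul_one]
  · rw [add_mul, mul_add, (hc.pow_right m).eq, mul_assoc (Q * h), hmQ, mul_assoc Q h Q,
      ← mul_assoc (φ ^ m) Q, hQm, mul_zero, zero_mul]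

theorem MinusLe.oneGDLe {k V : Type*} [Field k] [AddCommGroup V] [Module k V]
    {φ ψ : Module.End k V} {W U : Submodule k V} {m : ℕ} (hA : IsAST φ W U m)
    (hr : LinearMap.range (ψ - φ) ≤ U) (H : MinusLe φ ψ) : OneGDLe φ m ψ := by
  obtain ⟨h, hh, h1, h2⟩ := H
  have hφ : φ * h * φ = φ := hh
  obtain ⟨P, hPW, hPU, hPw, hPu, hPφ⟩ := hA.exists_projection
  have hP : Commute P φ := LinearMap.ext hPφ
  have hPP : P * P = P := LinearMap.ext fun x => hPw _ (hPW x)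
  have hQ : Commute (1 - P) φ := (Commute.one_left φ).sub_left hP
  have hQQ : (1 - P) * (1 - P) = 1 - P := IsIdempotentElem.one_sub hPP
  have hhP : φ * h * P = P := by
    ext x
    obtain ⟨y, -, hy⟩ := hA.exists_apply_eq (hPW x)
    simp only [Module.End.mul_apply]
    rw [← hy, hh.apply]
  have hinj : ∀ x, φ (P x) = 0 → P x = 0 := fun x hx =>
    hA.eq_zero_of_pow_apply_eq_zero 1 (hPW x) (by rwa [pow_one])
  have hQm : φ ^ m * (1 - P) = 0 := LinearMap.ext fun x => hA.pow_apply_eq_zero (hPU x)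
  have hPd : P * (ψ - φ) = 0 := LinearMap.ext fun x => hPu _ (hr ⟨x, rfl⟩)
  have hg := hh.isGDrazin_compression (add_sub_cancel P 1) hPP hQQ hP hQ hhP hinj hQm
  have hQd : (1 - P) * (ψ - φ) = ψ - φ := by rw [sub_mul, hPd, one_mul, sub_zero]
  have hPPh : φ * (P * h * P) = P := by
    rw [mul_assoc P, ← mul_assoc, ← hP.eq, mul_assoc, ← mul_assoc φ, hhP, hPP]
  generalize 1 - P = Q at *
  set Y := P + Q * φ * h * Q with hY
  have hφY : φ * (h * Y) = Y := by
    have : φ * h * (Q * φ * h * Q) = Q * φ * h * Q := by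
      rw [hQ.eq]
      calc φ * h * (φ * Q * h * Q) = (φ * h * φ) * Q * h * Q := by simp only [mul_assoc]
        _ = φ * Q * h * Q := by rw [hφ]
    rw [← mul_assoc, hY, mul_add, hhP, this]
  have hφg : φ * (P * h * P + Q * h * Q) = Y := by
    rw [mul_add, hPPh, hY, hQ.eq]
    simp only [mul_assoc]
  have hYφ : Y * φ = φ := by rw [← hφg, hg.1]
  have hτφ : IsOneInv φ (h * Y) := by rw [IsOneInv, hφY, hYφ]
  have hYd : h * Y * (ψ - φ) = 0 := by
    have hhd : h * (ψ - φ) = 0 := by rw [mul_sub, h1, sub_self]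
    rw [mul_assoc, hY, add_mul, hPd, mul_assoc _ Q, hQd, mul_assoc _ h, hhd, mul_zero, add_zero,
      mul_zero]
  refine ⟨h * Y, ⟨?_, h * Y, P * h * P + Q * h * Q, hτφ, hg, rfl, by rw [hφY, hφg]⟩, ?_, ?_⟩
  · have hYY : Y * Y = Y := by
      nth_rewrite 2 [← hφY]
      rw [← mul_assoc, hYφ, hφY]
    rw [mul_assoc (h * Y), hφY, mul_assoc, hYY]
  · rw [← mul_assoc, ← mul_assoc, h2]
  · rw [mul_sub, sub_eq_zero] at hYd
    exact hYd.symm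

theorem stmt17 {k V : Type*} [Field k] [AddCommGroup V] [Module k V]
    (φ ψ : Module.End k V) (Wφ Uφ : Submodule k V) (m : ℕ)
    (hASTφ : IsAST φ Wφ Uφ m) (hψ : IsFinitePotent ψ) :
    OneGDLe φ m ψ ↔ LinearMap.range (ψ - φ) ≤ Uφ ∧ MinusLe φ ψ := by
  exact ⟨fun H => ⟨H.range_sub_le hASTφ, H.minusLe⟩, fun H => H.2.oneGDLe hASTφ H.1⟩
end

section
/- The relation ≤^{1GD} is a partial order on the set of finite potent endomorphisms of V: for all finite potent φ, ψ, γ ∈ End(V), (i) φ ≤^{1GD} φ; (ii) if φ ≤^{1GD} ψ and ψ ≤^{1GD} φ then φ = ψ; (iii) if φ ≤^{1GD} ψ and ψ ≤^{1GD} γ then φ ≤^{1GD} γ. -/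
/-- Strongly π-regular elements have a Drazin inverse. -/
theorem exists_drazin_of_pow_eq {R : Type*} [Ring R] {a x y : R} {m : ℕ}
    (hx : a ^ (m + 1) * x = a ^ m) (hy : y * a ^ (m + 1) = a ^ m) :
    ∃ d, Commute a d ∧ a ^ (m + 1) * d = a ^ m ∧ d * a * d = d := by
  have hxj (j : ℕ) : a ^ (m + j) * x ^ j = a ^ m := by
    induction j with
    | zero => simp
    | succ j ih =>
      rw [← ih, show m + (j + 1) = j + (m + 1) by lia, pow_add a j, pow_succ' x, mul_assoc,
        ← mul_assoc _ x, hx, ← mul_assoc, ← pow_add, add_comm j]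
  have hyj (j : ℕ) : y ^ j * a ^ (m + j) = a ^ m := by
    induction j with
    | zero => simp
    | succ j ih =>
      rw [← ih, show m + (j + 1) = (m + 1) + j by lia, pow_add a (m + 1), pow_succ y, mul_assoc,
        ← mul_assoc y, hy, ← pow_add]
  have hxy : SemiconjBy (a ^ m) x y := by
    calc a ^ m * x = y * a ^ (m + 1) * x := by rw [hy]
      _ = y * a ^ m := by rw [mul_assoc, hx]
  have hxyj (j : ℕ) : a ^ m * x ^ j = y ^ j * a ^ m := hxy.pow_right j
  have had : a * (a ^ m * x ^ (m + 1)) = a ^ m * x ^ m := by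
    rw [← mul_assoc, ← pow_succ', pow_succ' x, ← mul_assoc, hx]
  have hda : a ^ m * x ^ (m + 1) * a = a ^ m * x ^ m := by
    rw [hxyj, hxyj, mul_assoc, ← pow_succ, pow_succ y, mul_assoc, hy]
  refine ⟨a ^ m * x ^ (m + 1), had.trans hda.symm, ?_, ?_⟩
  · rw [← mul_assoc, ← pow_add, add_comm, hxj]
  · rw [hda, hxyj, mul_assoc, ← mul_assoc (a ^ m), ← pow_add, pow_succ x, ← mul_assoc (a ^ _),
      hxj, ← mul_assoc, ← hxyj, mul_assoc]

section

variable {k V : Type*} [Field k] [AddCommGroup V] [Module k V]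

theorem exists_isOneInv (φ : Module.End k V) : ∃ h, IsOneInv φ h := by
  obtain ⟨s, hs⟩ := φ.rangeRestrict.exists_rightInverse_of_surjective φ.range_rangeRestrict
  obtain ⟨t, ht⟩ := LinearMap.exists_extend s
  refine ⟨t, LinearMap.ext fun v => ?_⟩
  have h1 : t (φ v) = s (φ.rangeRestrict v) := LinearMap.congr_fun ht (φ.rangeRestrict v)
  have h2 := congrArg Subtype.val (LinearMap.congr_fun hs (φ.rangeRestrict v))
  simpa [h1] using h2

theorem IsFinitePotent.exists_pow_stable {φ : Module.End k V} (hφ : IsFinitePotent φ) :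
    ∃ N, LinearMap.ker (φ ^ N) = LinearMap.ker (φ ^ (N + 1)) ∧
      LinearMap.range (φ ^ N) = LinearMap.range (φ ^ (N + 1)) := by
  obtain ⟨n, hn⟩ := hφ
  have hle (N : ℕ) : LinearMap.range (φ ^ (N + 1)) ≤ LinearMap.range (φ ^ N) := by
    rw [pow_succ]
    exact LinearMap.range_comp_le_range φ (φ ^ N)
  have hfin (j : ℕ) : FiniteDimensional k (LinearMap.range (φ ^ (n + j))) := by
    rw [pow_add]
    exact Submodule.finiteDimensional_of_le (LinearMap.range_comp_le_range (φ ^ j) (φ ^ n))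
  let f (j : ℕ) : ℕ := Module.finrank k (LinearMap.range (φ ^ (n + j)))
  let j := Function.argmin f
  have hfj : f j ≤ f (j + 1) := Function.argmin_le f (j + 1)
  have := hfin j
  have hr : LinearMap.range (φ ^ (n + j + 1)) = LinearMap.range (φ ^ (n + j)) :=
    Submodule.eq_of_le_of_finrank_le (hle _) hfj
  refine ⟨n + j, le_antisymm ?_ fun v hv => ?_, hr.symm⟩
  · rw [pow_succ']
    exact LinearMap.ker_le_ker_comp (φ ^ (n + j)) φ
  · generalize n + j = N at *
    have hmaps : ∀ w ∈ LinearMap.range (φ ^ N), φ w ∈ LinearMap.range (φ ^ N) := by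
      rintro _ ⟨w, rfl⟩
      exact ⟨φ w, by rw [← Module.End.mul_apply, ← Module.End.mul_apply, pow_mul_comm']⟩
    have hsurj : Function.Surjective (φ.restrict hmaps) := by
      rintro ⟨w, hw⟩
      rw [← hr, pow_succ'] at hw
      obtain ⟨z, rfl⟩ := hw
      exact ⟨⟨(φ ^ N) z, z, rfl⟩, rfl⟩
    have hinj := LinearMap.injective_iff_surjective.mpr hsurj
    rw [pow_succ'] at hv
    exact congrArg Subtype.val (@hinj ⟨(φ ^ N) v, v, rfl⟩ 0 (Subtype.ext (by simpa using hv)))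

theorem IsFinitePotent.ker_pow_endIndex {φ : Module.End k V} (hφ : IsFinitePotent φ) :
    LinearMap.ker (φ ^ endIndex φ) = LinearMap.ker (φ ^ (endIndex φ + 1)) :=
  Nat.sInf_mem (s := {m | LinearMap.ker (φ ^ m) = LinearMap.ker (φ ^ (m + 1))})
    (hφ.exists_pow_stable.imp fun _ h => h.1)

theorem IsFinitePotent.pow_endIndex_mul_eq_zero {φ χ : Module.End k V} (hφ : IsFinitePotent φ)
    {n : ℕ} (h : φ ^ (endIndex φ + n) * χ = 0) : φ ^ endIndex φ * χ = 0 := by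
  ext v
  have hv : χ v ∈ LinearMap.ker (φ ^ (endIndex φ + n)) := LinearMap.congr_fun h v
  rwa [← Module.End.ker_pow_constant hφ.ker_pow_endIndex] at hv

theorem IsFinitePotent.exists_drazin {φ : Module.End k V} (hφ : IsFinitePotent φ) :
    ∃ d, Commute φ d ∧ φ ^ (endIndex φ + 1) * d = φ ^ endIndex φ ∧ d * φ * d = d := by
  obtain ⟨N, hk, hr⟩ := hφ.exists_pow_stable
  obtain ⟨j, rfl⟩ : ∃ j, N = endIndex φ + j := Nat.exists_eq_add_of_le (Nat.sInf_le hk)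
  obtain ⟨b, hb⟩ := exists_isOneInv (φ ^ (endIndex φ + 1))
  obtain ⟨c, hc⟩ := exists_isOneInv (φ ^ (endIndex φ + j + 1))
  refine exists_drazin_of_pow_eq (x := c * φ ^ (endIndex φ + j)) (y := φ ^ endIndex φ * b) ?_ ?_
  · rw [← sub_eq_zero, pow_succ, mul_assoc, ← mul_sub_one]
    refine hφ.pow_endIndex_mul_eq_zero (n := j) ?_
    rw [mul_sub_one, ← mul_assoc, ← pow_succ, sub_eq_zero]
    ext v
    obtain ⟨z, hz⟩ : (φ ^ (endIndex φ + j)) v ∈ LinearMap.range (φ ^ (endIndex φ + j + 1)) :=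
      hr ▸ ⟨v, rfl⟩
    simpa [hz] using LinearMap.congr_fun hc z
  · rw [← sub_eq_zero, mul_assoc, ← mul_sub_one]
    refine hφ.pow_endIndex_mul_eq_zero (n := 1) ?_
    rw [mul_sub_one, ← mul_assoc, sub_eq_zero]
    exact hb

theorem IsOneInv.isGDrazin {φ d b : Module.End k V} {m : ℕ} (hb : IsOneInv φ b)
    (hc : Commute φ d) (hm : φ ^ (m + 1) * d = φ ^ m) (hd : d * φ * d = d) :
    IsGDrazin φ m (d + (1 - φ * d) * b * (1 - φ * d)) := by
  unfold IsOneInv at hb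
  have hl : φ ^ m * (1 - φ * d) = 0 := by
    rw [mul_sub, mul_one, ← mul_assoc, ← pow_succ, hm, sub_self]
  have he : Commute φ (1 - φ * d) :=
    (Commute.one_right φ).sub_right ((Commute.refl φ).mul_right hc)
  have hr : (1 - φ * d) * φ ^ m = 0 := by rw [← (he.pow_left _).eq, hl]
  have hi : (1 - φ * d) * (1 - φ * d) = 1 - φ * d :=
    IsIdempotentElem.one_sub (by rw [IsIdempotentElem, mul_assoc, ← mul_assoc d, hd])
  refine ⟨?_, ?_⟩
  · calc φ * (d + (1 - φ * d) * b * (1 - φ * d)) * φ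
        = φ * d * φ + φ * (1 - φ * d) * b * ((1 - φ * d) * φ) := by
          simp only [mul_add, add_mul, mul_assoc]
      _ = φ * d * φ + (1 - φ * d) * (φ * b * φ) * (1 - φ * d) := by
          rw [← he.eq, he.eq]
          simp only [mul_assoc]
          rw [← mul_assoc φ, he.eq, mul_assoc]
      _ = φ := by rw [hb, mul_assoc _ φ, he.eq, ← mul_assoc, hi, ← add_mul, add_sub_cancel, one_mul]
  · rw [add_mul, mul_add, mul_assoc _ _ (φ ^ _), hr, mul_zero, mul_assoc (1 - φ * d),
      ← mul_assoc (φ ^ _) (1 - φ * d), hl, zero_mul, (hc.pow_left _).eq]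

theorem IsFinitePotent.is1GD_iff {φ τ : Module.End k V} (hφ : IsFinitePotent φ) :
    Is1GD φ (endIndex φ) τ ↔
      τ * φ * τ = τ ∧ φ * τ * φ = φ ∧ φ ^ (endIndex φ + 1) * τ = φ ^ endIndex φ := by
  obtain ⟨d, hc, hm, hd⟩ := hφ.exists_drazin
  constructor
  · rintro ⟨h1, h, g, -, ⟨hg, hgm⟩, -, hφg⟩
    refine ⟨h1, by rw [hφg, hg], ?_⟩
    calc φ ^ (endIndex φ + 1) * τ = φ * (φ ^ endIndex φ * g) := by
          rw [pow_succ, mul_assoc, hφg, ← mul_assoc, ← mul_assoc, pow_mul_comm']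
      _ = φ * g * (φ ^ (endIndex φ + 1) * d) := by rw [hm, ← hgm, mul_assoc]
      _ = φ * g * φ * (φ ^ endIndex φ * d) := by simp only [pow_succ', mul_assoc]
      _ = φ ^ endIndex φ := by rw [hg, ← mul_assoc, ← pow_succ', hm]
  · rintro ⟨h1, h2, h3⟩
    have he : φ * d * (φ * τ) = φ * d := by
      have key (j : ℕ) : φ * d = d ^ j * φ ^ j * (φ * d) := by
        induction j with
        | zero => simp
        | succ j ih =>
          calc φ * d = d ^ j * φ ^ j * (φ * d) := ih
            _ = d ^ j * φ ^ j * (φ * (d * φ * d)) := by rw [hd]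
            _ = d ^ j * φ ^ j * (d * φ * (φ * d)) := by
              rw [mul_assoc d, ← mul_assoc φ d, hc.eq]
            _ = d ^ j * (φ ^ j * d) * (φ * (φ * d)) := by simp only [mul_assoc]
            _ = d ^ (j + 1) * φ ^ (j + 1) * (φ * d) := by
              rw [(hc.pow_left j).eq]
              simp only [pow_succ, mul_assoc]
      have hpow : φ * d = d ^ endIndex φ * φ ^ endIndex φ := by
        rw [key (endIndex φ), mul_assoc, ← mul_assoc (φ ^ _), ← pow_succ, hm]
      rw [hpow, mul_assoc, ← mul_assoc (φ ^ _), ← pow_succ, h3]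
    refine ⟨h1, τ, _, h2, IsOneInv.isGDrazin h2 hc hm hd, rfl, ?_⟩
    have hcomm : Commute φ (1 - φ * d) :=
      (Commute.one_right φ).sub_right ((Commute.refl φ).mul_right hc)
    have ht : (1 - φ * d) * (φ * τ) * (φ * d) = (1 - φ * d) * (φ * d) := by
      rw [mul_assoc, ← mul_assoc (φ * τ), h2]
    calc φ * τ = φ * d + (φ * τ - φ * d * (φ * τ)) - (1 - φ * d) * (φ * d) := by
          rw [he, sub_mul, one_mul, mul_assoc φ d (φ * d), ← mul_assoc d, hd]
          abel
      _ = φ * d + ((1 - φ * d) * (φ * τ) - (1 - φ * d) * (φ * τ) * (φ * d)) := by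
          rw [ht, sub_mul 1 (φ * d) (φ * τ), one_mul, add_sub_assoc]
      _ = φ * d + (1 - φ * d) * (φ * τ) * (1 - φ * d) := by rw [mul_sub, mul_one]
      _ = φ * (d + (1 - φ * d) * τ * (1 - φ * d)) := by
          rw [mul_add, ← mul_assoc, ← mul_assoc, ← mul_assoc, hcomm.eq]

/-- Reflexivity of the 1GD relation. -/
theorem OneGDLe.refl {φ : Module.End k V} (hφ : IsFinitePotent φ) :
    OneGDLe φ (endIndex φ) φ := by
  obtain ⟨d, hc, hm, hd⟩ := hφ.exists_drazin
  obtain ⟨b, hb⟩ := exists_isOneInv φ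
  obtain ⟨hg, hgm⟩ := hb.isGDrazin hc hm hd
  generalize d + (1 - φ * d) * b * (1 - φ * d) = g at hg hgm
  refine ⟨g * φ * g, ⟨?_, g, g, hg, ⟨hg, hgm⟩, ?_, ?_⟩, rfl, rfl⟩
  · calc g * φ * g * φ * (g * φ * g) = g * (φ * g * φ) * g * φ * g := by simp only [mul_assoc]
      _ = g * φ * g * φ * g := by rw [hg]
      _ = g * φ * g := by rw [mul_assoc g, mul_assoc g, hg, mul_assoc]
  · rw [mul_assoc, mul_assoc, ← mul_assoc φ, hg]
  · rw [← mul_assoc, ← mul_assoc, hg]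

/-- Antisymmetry of the 1GD relation. -/
theorem OneGDLe.antisymm {φ ψ : Module.End k V} (hφ : IsFinitePotent φ) (hψ : IsFinitePotent ψ)
    (h₁ : OneGDLe φ (endIndex φ) ψ) (h₂ : OneGDLe ψ (endIndex ψ) φ) : φ = ψ := by
  obtain ⟨τ, hτ, -, hτr⟩ := h₁
  obtain ⟨σ, hσ, hσl, -⟩ := h₂
  obtain ⟨-, hτ, -⟩ := hφ.is1GD_iff.mp hτ
  obtain ⟨-, hσ, -⟩ := hψ.is1GD_iff.mp hσ
  calc φ = φ * τ * ψ := by rw [mul_assoc, ← hτr, ← mul_assoc, hτ]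
    _ = φ * τ * (φ * σ * ψ) := by rw [← hσl, hσ]
    _ = φ * τ * φ * (σ * ψ) := by simp only [mul_assoc]
    _ = ψ := by rw [hτ, ← mul_assoc, ← hσl, hσ]

/-- Transitivity of the 1GD relation. -/
theorem OneGDLe.trans {φ ψ γ : Module.End k V} (hφ : IsFinitePotent φ) (hψ : IsFinitePotent ψ)
    (h₁ : OneGDLe φ (endIndex φ) ψ) (h₂ : OneGDLe ψ (endIndex ψ) γ) :
    OneGDLe φ (endIndex φ) γ := by
  obtain ⟨τ, hτ, hτl, hτr⟩ := h₁
  obtain ⟨σ, hσ, hσl, hσr⟩ := h₂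
  obtain ⟨-, hτ, hτm⟩ := hφ.is1GD_iff.mp hτ
  obtain ⟨-, hσ, hσm⟩ := hψ.is1GD_iff.mp hσ
  have hl : φ * τ * ψ = φ := by rw [mul_assoc, ← hτr, ← mul_assoc, hτ]
  have hr : ψ * τ * φ = φ := by rw [← hτl, hτ]
  have hψσ : φ * σ * ψ = φ := by
    calc φ * σ * ψ = φ * τ * (ψ * σ * ψ) := by nth_rw 1 [← hl]; simp only [mul_assoc]
      _ = φ := by rw [hσ, hl]
  have hσφ : ψ * σ * φ = φ := by
    calc ψ * σ * φ = ψ * σ * ψ * (τ * φ) := by nth_rw 1 [← hr]; simp only [mul_assoc]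
      _ = φ := by rw [hσ, ← mul_assoc, hr]
  have hφσφ : φ * σ * φ = φ := by
    calc φ * σ * φ = φ * σ * ψ * (τ * φ) := by nth_rw 2 [← hr]; simp only [mul_assoc]
      _ = φ := by rw [hψσ, ← mul_assoc, hτ]
  have hφψ : φ ^ endIndex φ * ψ = φ ^ (endIndex φ + 1) := by
    rw [← hτm, pow_succ, mul_assoc, mul_assoc, ← mul_assoc φ, hl]
  have hφψn (n : ℕ) : φ ^ endIndex φ * ψ ^ n = φ ^ (endIndex φ + n) := by
    induction n with
    | zero => simp
    | succ n ih =>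
      rw [pow_succ', ← mul_assoc, hφψ, pow_succ', mul_assoc, ih, ← pow_succ', add_assoc]
  have hφσm : φ ^ (endIndex φ + 1) * σ = φ ^ endIndex φ := by
    rw [← hφψ, mul_assoc, ← sub_eq_zero, ← mul_sub_one]
    refine hφ.pow_endIndex_mul_eq_zero (n := endIndex ψ) ?_
    rw [← hφψn, mul_assoc, mul_sub_one, ← mul_assoc (ψ ^ _), ← pow_succ, hσm, sub_self, mul_zero]
  have hφρ : φ * (σ * φ * σ) = φ * σ := by rw [← mul_assoc, ← mul_assoc, hφσφ]
  have hρφ : σ * φ * σ * φ = σ * φ := by rw [mul_assoc, mul_assoc, ← mul_assoc φ, hφσφ]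
  refine ⟨σ * φ * σ, hφ.is1GD_iff.mpr ⟨?_, ?_, ?_⟩, ?_, ?_⟩
  · rw [hρφ, mul_assoc, hφρ, ← mul_assoc]
  · rw [hφρ, hφσφ]
  · rw [pow_succ, mul_assoc, hφρ, ← mul_assoc, ← pow_succ, hφσm]
  · rw [hφρ, ← mul_assoc, ← mul_assoc, ← hσl, hσφ]
  · rw [hρφ, mul_assoc, ← hσr, mul_assoc, ← mul_assoc φ, hψσ]

end

theorem stmt18 {k V : Type*} [Field k] [AddCommGroup V] [Module k V] :
    (∀ φ : Module.End k V, IsFinitePotent φ → OneGDLe φ (endIndex φ) φ) ∧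
    (∀ φ ψ : Module.End k V, IsFinitePotent φ → IsFinitePotent ψ →
      OneGDLe φ (endIndex φ) ψ → OneGDLe ψ (endIndex ψ) φ → φ = ψ) ∧
    (∀ φ ψ γ : Module.End k V, IsFinitePotent φ → IsFinitePotent ψ →
      IsFinitePotent γ → OneGDLe φ (endIndex φ) ψ → OneGDLe ψ (endIndex ψ) γ →
      OneGDLe φ (endIndex φ) γ) :=
  ⟨fun _ hφ => OneGDLe.refl hφ, fun _ _ hφ hψ h₁ h₂ => OneGDLe.antisymm hφ hψ h₁ h₂,
    fun _ _ _ hφ hψ _ h₁ h₂ => OneGDLe.trans hφ hψ h₁ h₂⟩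
end
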